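/- arXiv:1807.08354 — 6 statements merged into one kernel-verified Lean document; each statement's English description precedes it below -/
import Mathlib

section
/- For every triangulation T of a convex hexagon (n = 6), there exists a diagonal d ∈ T that dominates T; consequently the two endpoints of d form a dominating vertex set of size 2 = ⌊6/3⌋ containing an endpoint of d. -/
/-!
Combinatorial model of a triangulated convex `n`-gon.
Vertices are elements of `ZMod n` in cyclic order; polygon edges are the
unordered pairs `{i, i+1}`; diagonals are other unordered pairs; two diagonals
cross when their endpoints strictly interleave in cyclic order; a triangulation
is a set of `n - 3` pairwise non-crossing diagonals.
-/

/-- The unordered pair `e` is a polygon edge `{i, i+1}`. -/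
def IsPolygonEdge (n : ℕ) (e : Finset (ZMod n)) : Prop :=
  ∃ i : ZMod n, e = {i, i + 1}

/-- `x` lies strictly inside the open cyclic arc from `a` to `b`
(going in the positive cyclic direction). -/
def InOpenArc (n : ℕ) (a b x : ZMod n) : Prop :=
  0 < (x - a).val ∧ (x - a).val < (b - a).val

/-- Two unordered pairs cross: their endpoints strictly interleave in cyclic
order, i.e. one endpoint of the second lies strictly inside one open arc
determined by the first and the other endpoint lies strictly inside the other
open arc. -/
def Crosses (n : ℕ) (e₁ e₂ : Finset (ZMod n)) : Prop :=
  ∃ a b c d : ZMod n, e₁ = {a, b} ∧ e₂ = {c, d} ∧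
    InOpenArc n a b c ∧ InOpenArc n b a d

/-- A diagonal is an unordered pair of two distinct vertices that is not a
polygon edge. -/
def IsDiagonal (n : ℕ) (d : Finset (ZMod n)) : Prop :=
  d.card = 2 ∧ ¬ IsPolygonEdge n d

/-- A triangulation of the convex `n`-gon: a set of `n - 3` pairwise
non-crossing diagonals. -/
def IsTriangulation (n : ℕ) (T : Finset (Finset (ZMod n))) : Prop :=
  T.card = n - 3 ∧ (∀ d ∈ T, IsDiagonal n d) ∧
    ∀ d₁ ∈ T, ∀ d₂ ∈ T, d₁ ≠ d₂ → ¬ Crosses n d₁ d₂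

/-- A triangle of the triangulation `T`: a 3-element set of vertices each pair
of which is either a polygon edge or a diagonal of `T`. -/
def IsTriangleOf (n : ℕ) (T : Finset (Finset (ZMod n))) (t : Finset (ZMod n)) : Prop :=
  t.card = 3 ∧ ∀ x ∈ t, ∀ y ∈ t, x ≠ y → IsPolygonEdge n {x, y} ∨ {x, y} ∈ T

/-- A set `S` of vertices dominates `T` if every triangle of `T` contains a
vertex of `S`. -/
def VertexDominates (n : ℕ) (T : Finset (Finset (ZMod n))) (S : Finset (ZMod n)) : Prop :=
  ∀ t, IsTriangleOf n T t → ∃ v ∈ S, v ∈ t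

/-- A set `H` of diagonals dominates `T` if every triangle of `T` contains an
endpoint of some diagonal in `H`. -/
def DiagDominates (n : ℕ) (T H : Finset (Finset (ZMod n))) : Prop :=
  ∀ t, IsTriangleOf n T t → ∃ d ∈ H, ∃ v ∈ d, v ∈ t

/-- An ear of `T`: a triangle of `T` two of whose three sides are polygon
edges. -/
def IsEar (n : ℕ) (T : Finset (Finset (ZMod n))) (t : Finset (ZMod n)) : Prop :=
  IsTriangleOf n T t ∧ ∃ a b c : ZMod n, t = {a, b, c} ∧
    IsPolygonEdge n {a, b} ∧ IsPolygonEdge n {b, c}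

/-- The nine diagonals of the hexagon. -/
def hexDiags : Finset (Finset (ZMod 6)) :=
  {{0, 2}, {1, 3}, {2, 4}, {3, 5}, {4, 0}, {5, 1}, {0, 3}, {1, 4}, {2, 5}}

theorem hexDiags_complete : ∀ d : Finset (ZMod 6), IsDiagonal 6 d → d ∈ hexDiags := by
  unfold IsDiagonal IsPolygonEdge
  decide +kernel

theorem hex_cross_short : ∀ i : ZMod 6, Crosses 6 {i, i + 2} {i + 1, i + 3} := fun i =>
  ⟨i, i + 2, i + 1, i + 3, rfl, rfl, by unfold InOpenArc; revert i; decide,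
    by unfold InOpenArc; revert i; decide⟩

theorem hex_long : ∀ i : ZMod 6, ∀ t : Finset (ZMod 6), t.card = 3 → i ∉ t → i + 3 ∉ t →
    (i + 1 ∈ t ∨ i + 2 ∈ t) ∧ (i + 4 ∈ t ∨ i + 5 ∈ t) := by
  decide +kernel

theorem hex_long_arc : ∀ i x y : ZMod 6, (x = i + 1 ∨ x = i + 2) → (y = i + 4 ∨ y = i + 5) →
    (x ≠ y ∧ ({i, i + 3} : Finset (ZMod 6)) ≠ {x, y} ∧ ¬ (y = x + 1 ∨ x = y + 1)) ∧
    InOpenArc 6 i (i + 3) x ∧ InOpenArc 6 (i + 3) i y := by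
  unfold InOpenArc
  decide +kernel

theorem hexDiags_split : ∀ d ∈ hexDiags,
    (∃ i : ZMod 6, ({i, i + 2} : Finset (ZMod 6)) = d) ∨ ∃ i : ZMod 6, d = {i, i + 3} := by
  decide +kernel

theorem hex_short_inj : ∀ i j : ZMod 6,
    ({i, i + 2} : Finset (ZMod 6)) = {j, j + 2} → i = j := by
  decide +kernel

theorem hex_short_index : ∀ S : Finset (ZMod 6), S.card = 3 →
    (∀ i : ZMod 6, i ∈ S → i + 1 ∉ S) → ∃ i : ZMod 6, S = {i, i + 2, i + 4} := by
  decide +kernel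

theorem hex_wrap : ∀ i : ZMod 6, i + 4 + 2 = i ∧ i + 2 + 2 = i + 4 ∧ i + 1 + 2 = i + 3 := by
  decide

theorem hex_short (T : Finset (Finset (ZMod 6))) (hc : T.card = 3)
    (hs : ∀ d ∈ T, ∃ i : ZMod 6, ({i, i + 2} : Finset (ZMod 6)) = d)
    (hx : ∀ i : ZMod 6, {i, i + 2} ∈ T → {i + 1, i + 3} ∉ T) :
    ∃ i : ZMod 6, T = {{i, i + 2}, {i + 2, i + 4}, {i + 4, i}} := by
  obtain ⟨S, rfl⟩ : ∃ S : Finset (ZMod 6), S.image (fun i => ({i, i + 2} : Finset (ZMod 6))) = T := by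
    refine ⟨Finset.univ.filter (fun i => {i, i + 2} ∈ T), ?_⟩
    ext d
    simp only [Finset.mem_image, Finset.mem_filter, Finset.mem_univ, true_and]
    constructor
    · rintro ⟨i, hi, rfl⟩
      exact hi
    · intro h
      obtain ⟨i, rfl⟩ := hs d h
      exact ⟨i, h, rfl⟩
  rw [Finset.card_image_of_injective _ (fun i j h => hex_short_inj i j h)] at hc
  obtain ⟨i, rfl⟩ := hex_short_index S hc (fun i h1 h2 =>
    hx i (Finset.mem_image_of_mem _ h1) (by
      have := Finset.mem_image_of_mem (fun i => ({i, i + 2} : Finset (ZMod 6))) h2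
      simpa only [(hex_wrap i).2.2] using this))
  refine ⟨i, ?_⟩
  simp only [Finset.image_insert, Finset.image_singleton, (hex_wrap i).1, (hex_wrap i).2.1]

theorem hex_short_tri : ∀ i : ZMod 6, ∀ t : Finset (ZMod 6), t.card = 3 → i ∉ t → i + 2 ∉ t →
    (i + 1 ∈ t ∧ (i + 3 ∈ t ∨ i + 4 ∈ t ∨ i + 5 ∈ t)) ∨ (i + 3 ∈ t ∧ i + 5 ∈ t) := by
  decide +kernel

theorem hex_short_pair : ∀ i x y : ZMod 6,
    (x = i + 1 ∧ (y = i + 3 ∨ y = i + 4 ∨ y = i + 5)) ∨ (x = i + 3 ∧ y = i + 5) →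
    x ≠ y ∧ ¬ (y = x + 1 ∨ x = y + 1) ∧
    ({x, y} : Finset (ZMod 6)) ∉
      ({{i, i + 2}, {i + 2, i + 4}, {i + 4, i}} : Finset (Finset (ZMod 6))) := by
  decide +kernel

theorem hex_edge : ∀ x y : ZMod 6, IsPolygonEdge 6 {x, y} → (y = x + 1 ∨ x = y + 1) := by
  unfold IsPolygonEdge
  decide +kernel

/-- For every triangulation `T` of a convex hexagon, there is a diagonal
`d ∈ T` dominating `T`; consequently its two endpoints form a dominating
vertex set of size `2 = ⌊6/3⌋` containing an endpoint of `d`. -/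
theorem hexagon_dominating_diagonal (T : Finset (Finset (ZMod 6)))
    (hT : IsTriangulation 6 T) :
    ∃ d ∈ T, (∀ t, IsTriangleOf 6 T t → ∃ v ∈ d, v ∈ t) ∧
      d.card = 2 ∧ VertexDominates 6 T d := by
  obtain ⟨hc, hd, hx⟩ := hT
  have main : ∃ d ∈ T, ∀ t, IsTriangleOf 6 T t → ∃ v ∈ d, v ∈ t := by
    by_cases hl : ∃ i : ZMod 6, ({i, i + 3} : Finset (ZMod 6)) ∈ T
    · obtain ⟨i, hi⟩ := hl
      refine ⟨_, hi, fun t ht => ?_⟩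
      by_contra hcon
      have h1 : i ∉ t := fun h => hcon ⟨i, by simp, h⟩
      have h2 : i + 3 ∉ t := fun h => hcon ⟨i + 3, by simp, h⟩
      obtain ⟨x, hxt, y, hyt, hx1, hy1⟩ : ∃ x ∈ t, ∃ y ∈ t,
          (x = i + 1 ∨ x = i + 2) ∧ (y = i + 4 ∨ y = i + 5) := by
        obtain ⟨ha | ha, hb | hb⟩ := hex_long i t ht.1 h1 h2
        all_goals exact ⟨_, ha, _, hb, by simp, by simp⟩
      obtain ⟨⟨hne, hne2, hedge⟩, ha, hb⟩ := hex_long_arc i x y hx1 hy1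
      rcases ht.2 x hxt y hyt hne with h | h
      · exact hedge (hex_edge x y h)
      · exact hx _ hi _ h hne2 ⟨i, i + 3, x, y, rfl, rfl, ha, hb⟩
    · have hmem : ∀ d ∈ T, ∃ i : ZMod 6, ({i, i + 2} : Finset (ZMod 6)) = d := by
        intro d h
        rcases hexDiags_split d (hexDiags_complete d (hd d h)) with h' | ⟨i, rfl⟩
        · exact h'
        · exact absurd ⟨i, h⟩ hl
      obtain ⟨i, hi⟩ := hex_short T hc hmem (fun i h1 h2 =>
        hx _ h1 _ h2 (by clear h1 h2; revert i; decide) (hex_cross_short i))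
      refine ⟨{i, i + 2}, by simp [hi], fun t ht => ?_⟩
      by_contra hcon
      have h1 : i ∉ t := fun h => hcon ⟨i, by simp, h⟩
      have h2 : i + 2 ∉ t := fun h => hcon ⟨i + 2, by simp, h⟩
      have bad : ∀ x ∈ t, ∀ y ∈ t,
          ¬ ((x = i + 1 ∧ (y = i + 3 ∨ y = i + 4 ∨ y = i + 5)) ∨ (x = i + 3 ∧ y = i + 5)) := by
        intro x hxt y hyt h
        obtain ⟨hne, hedge, hnT⟩ := hex_short_pair i x y h
        rcases ht.2 x hxt y hyt hne with h | h
        · exact hedge (hex_edge x y h)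
        · exact hnT (hi ▸ h)
      rcases hex_short_tri i t ht.1 h1 h2 with ⟨ha, hb | hb | hb⟩ | ⟨ha, hb⟩
      all_goals exact bad _ ha _ hb (by simp)
  obtain ⟨d, hdT, key⟩ := main
  exact ⟨d, hdT, key, (hd d hdT).1, key⟩
end

section
/- For every triangulation T of a convex hexagon (n = 6), there exist a vertex v0 and an ear T1 of T such that for every vertex w of T1, the two-element set {v0, w} dominates T. -/
instance decEdge (e : Finset (ZMod 6)) : Decidable (IsPolygonEdge 6 e) :=
  inferInstanceAs (Decidable (∃ i : ZMod 6, e = {i, i + 1}))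

instance decArc (a b x : ZMod 6) : Decidable (InOpenArc 6 a b x) :=
  inferInstanceAs (Decidable (_ ∧ _))

instance decDiagonal (d : Finset (ZMod 6)) : Decidable (IsDiagonal 6 d) :=
  inferInstanceAs (Decidable (_ ∧ _))

instance decTriangle (T : Finset (Finset (ZMod 6))) (t : Finset (ZMod 6)) :
    Decidable (IsTriangleOf 6 T t) :=
  inferInstanceAs (Decidable (_ ∧ ∀ x ∈ t, ∀ y ∈ t, x ≠ y → _))

instance decDominates (T : Finset (Finset (ZMod 6))) (S : Finset (ZMod 6)) :
    Decidable (VertexDominates 6 T S) :=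
  inferInstanceAs (Decidable (∀ t, IsTriangleOf 6 T t → ∃ v ∈ S, v ∈ t))

instance decEar (T : Finset (Finset (ZMod 6))) (t : Finset (ZMod 6)) :
    Decidable (IsEar 6 T t) :=
  inferInstanceAs (Decidable (_ ∧ ∃ a b c : ZMod 6, t = {a, b, c} ∧
    IsPolygonEdge 6 {a, b} ∧ IsPolygonEdge 6 {b, c}))

/-- The nine diagonals of the hexagon. -/
def hexDiagonals : Finset (Finset (ZMod 6)) :=
  {{0, 2}, {0, 3}, {0, 4}, {1, 3}, {1, 4}, {1, 5}, {2, 4}, {2, 5}, {3, 5}}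

theorem mem_hexDiagonals : ∀ d : Finset (ZMod 6), IsDiagonal 6 d → d ∈ hexDiagonals := by
  decide +kernel

theorem arc_pair_ne : ∀ a b c d : ZMod 6, InOpenArc 6 a b c → InOpenArc 6 b a d →
    ({a, b} : Finset (ZMod 6)) ≠ {c, d} := by
  decide +kernel

theorem hexagon_finite_check : ∀ T ∈ hexDiagonals.powersetCard 3,
    (∀ a b : ZMod 6, {a, b} ∈ T → ∀ c, InOpenArc 6 a b c → ∀ d, InOpenArc 6 b a d →
      {c, d} ∉ T) →
    ∃ (v₀ : ZMod 6) (t₁ : Finset (ZMod 6)), IsEar 6 T t₁ ∧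
      ∀ w ∈ t₁, VertexDominates 6 T {v₀, w} := by
  decide +kernel

/-- For every triangulation `T` of a convex hexagon, there exist a vertex `v₀`
and an ear `t₁` of `T` such that for every vertex `w` of `t₁`, the set
`{v₀, w}` dominates `T`. -/
theorem hexagon_vertex_and_ear (T : Finset (Finset (ZMod 6)))
    (hT : IsTriangulation 6 T) :
    ∃ (v₀ : ZMod 6) (t₁ : Finset (ZMod 6)), IsEar 6 T t₁ ∧
      ∀ w ∈ t₁, VertexDominates 6 T {v₀, w} := by
  obtain ⟨hcard, hdiag, hcross⟩ := hT
  refine hexagon_finite_check T ?_ ?_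
  · rw [Finset.mem_powersetCard]
    exact ⟨fun d hd => mem_hexDiagonals d (hdiag d hd), hcard⟩
  · intro a b hab c hc d hd hcd
    exact hcross _ hab _ hcd (arc_pair_ne a b c d hc hd) ⟨a, b, c, d, rfl, rfl, hc, hd⟩
end

section
/- For every triangulation T of a convex heptagon (n = 7) and every polygon edge e, there exists a set S of at most 2 vertices that dominates T such that some endpoint of e belongs to S. -/
/-- First (smaller) endpoint of the `i`-th diagonal of the heptagon. -/
def hepA (i : Fin 14) : Fin 7 := ![0, 0, 0, 0, 1, 1, 1, 1, 2, 2, 2, 3, 3, 4] i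

/-- Second (larger) endpoint of the `i`-th diagonal of the heptagon. -/
def hepB (i : Fin 14) : Fin 7 := ![2, 3, 4, 5, 3, 4, 5, 6, 4, 5, 6, 5, 6, 6] i

/-- The `i`-th diagonal of the heptagon. -/
def hepD (i : Fin 14) : Finset (ZMod 7) := {(hepA i : ZMod 7), (hepB i : ZMod 7)}

/-- Boolean crossing test for the listed diagonals. -/
def hepCr (i j : Fin 14) : Bool :=
  (decide (hepA i < hepA j) && decide (hepA j < hepB i) && decide (hepB i < hepB j)) ||
  (decide (hepA j < hepA i) && decide (hepA i < hepB j) && decide (hepB j < hepB i))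

/-- Adjacency of `x < y` in the triangulation made of four listed diagonals. -/
def hepAdj (i j k l : Fin 14) (x y : Fin 7) : Bool :=
  decide (y = x + 1) || decide (x = y + 1) ||
  [i, j, k, l].any fun m => decide (hepA m = x) && decide (hepB m = y)

/-- Boolean test that `{s, w}` meets every triangle. -/
def hepDom (i j k l : Fin 14) (s w : Fin 7) : Bool :=
  (List.finRange 7).all fun x => (List.finRange 7).all fun y =>
    !(decide (x < y)) || !(hepAdj i j k l x y) ||
    (List.finRange 7).all fun z =>
      !(decide (y < z)) || !(hepAdj i j k l y z) || !(hepAdj i j k l x z) ||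
      [x, y, z].any fun u => decide (u = s) || decide (u = w)

theorem hep_key : ∀ i j : Fin 14, i < j → hepCr i j = false →
    ∀ k : Fin 14, j < k → hepCr i k = false → hepCr j k = false →
    ∀ l : Fin 14, k < l → hepCr i l = false → hepCr j l = false → hepCr k l = false →
    ∀ v : Fin 7, ∃ w : Fin 7, hepDom i j k l v w = true ∨ hepDom i j k l (v + 1) w = true := by
  decide +kernel

theorem hep_cross (i j : Fin 14) (h : hepCr i j = true) : Crosses 7 (hepD i) (hepD j) := by
  have key : ∀ i j : Fin 14, hepCr i j = true →
      ((0 < (hepA j - hepA i).val ∧ (hepA j - hepA i).val < (hepB i - hepA i).val) ∧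
       (0 < (hepB j - hepB i).val ∧ (hepB j - hepB i).val < (hepA i - hepB i).val)) ∨
      ((0 < (hepB j - hepA i).val ∧ (hepB j - hepA i).val < (hepB i - hepA i).val) ∧
       (0 < (hepA j - hepB i).val ∧ (hepA j - hepB i).val < (hepA i - hepB i).val)) := by
    decide +kernel
  rcases key i j h with h | h
  · exact ⟨hepA i, hepB i, hepA j, hepB j, rfl, rfl, h.1, h.2⟩
  · exact ⟨hepA i, hepB i, hepB j, hepA j, rfl, Finset.pair_comm _ _, h.1, h.2⟩

theorem hep_diag (d : Finset (ZMod 7)) (h : IsDiagonal 7 d) : ∃ i, hepD i = d := by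
  obtain ⟨h1, h2⟩ := h
  obtain ⟨x, y, hxy, rfl⟩ := Finset.card_eq_two.1 h1
  have key : ∀ x y : ZMod 7, x ≠ y → (∃ i : ZMod 7, ({x, y} : Finset (ZMod 7)) = {i, i + 1}) ∨
      ∃ i, hepD i = {x, y} := by
    decide +kernel
  exact (key x y hxy).resolve_left h2

theorem hepD_inj : Function.Injective hepD := by
  have key : ∀ i j, hepD i = hepD j → i = j := by decide +kernel
  exact fun i j => key i j

theorem hep_adj (i j k l : Fin 14) (x y : Fin 7) (hxy : x < y)
    (h : IsPolygonEdge 7 {x, y} ∨ ∃ m ∈ [i, j, k, l], hepD m = {x, y}) :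
    hepAdj i j k l x y = true := by
  have k1 : ∀ x y : ZMod 7, (∃ i : ZMod 7, ({x, y} : Finset (ZMod 7)) = {i, i + 1}) → x ≠ y →
      (y = x + 1 ∨ x = y + 1) := by decide +kernel
  have k2 : ∀ (m : Fin 14) (x y : Fin 7), x < y → hepD m = ({x, y} : Finset (ZMod 7)) →
      hepA m = x ∧ hepB m = y := by decide +kernel
  unfold hepAdj
  rcases h with h | ⟨m, hm, h⟩
  · rcases k1 x y h hxy.ne with h | h
    · have h' : y = x + 1 := h
      rw [decide_eq_true h']; rfl
    · have h' : x = y + 1 := h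
      rw [decide_eq_true h', Bool.or_true]; rfl
  · obtain ⟨h3, h4⟩ := k2 m x y hxy h
    rw [Bool.or_eq_true]
    right
    rw [List.any_eq_true]
    exact ⟨m, hm, by simp [h3, h4]⟩

theorem hep_sound (T : Finset (Finset (ZMod 7))) (i j k l : Fin 14)
    (hT : ∀ d ∈ T, ∃ m ∈ [i, j, k, l], hepD m = d) (s w : Fin 7)
    (h : hepDom i j k l s w = true) : VertexDominates 7 T ({s, w} : Finset (Fin 7)) := by
  rintro t ⟨h3, ht⟩
  let t' : Finset (Fin 7) := t
  have h3' : t'.card = 3 := h3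
  let f := t'.orderEmbOfFin h3'
  have hf : ∀ a, f a ∈ t' := fun a => Finset.orderEmbOfFin_mem t' h3' a
  have hadj : ∀ a b, a < b → hepAdj i j k l (f a) (f b) = true := by
    intro a b hab
    have hlt : f a < f b := f.lt_iff_lt.2 hab
    refine hep_adj i j k l _ _ hlt ?_
    rcases ht (f a) (hf a) (f b) (hf b) hlt.ne with h | h
    · exact Or.inl h
    · exact Or.inr (hT _ h)
  have h01 : f 0 < f 1 := f.lt_iff_lt.2 (by decide)
  have h12 : f 1 < f 2 := f.lt_iff_lt.2 (by decide)
  unfold hepDom at h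
  rw [List.all_eq_true] at h
  have h := h (f 0) (List.mem_finRange _)
  rw [List.all_eq_true] at h
  have h := h (f 1) (List.mem_finRange _)
  rw [decide_eq_true h01, hadj 0 1 (by decide)] at h
  simp only [Bool.not_true, Bool.false_or] at h
  rw [List.all_eq_true] at h
  have h := h (f 2) (List.mem_finRange _)
  rw [decide_eq_true h12, hadj 1 2 (by decide), hadj 0 2 (by decide)] at h
  simp only [Bool.not_true, Bool.false_or] at h
  rw [List.any_eq_true] at h
  obtain ⟨u, hu, hs⟩ := h
  have hut : u ∈ t' := by
    simp only [List.mem_cons, List.not_mem_nil, or_false] at hu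
    rcases hu with rfl | rfl | rfl <;> exact hf _
  have hus : u ∈ ({s, w} : Finset (Fin 7)) := by simpa using hs
  exact ⟨u, hus, hut⟩

/-- For every triangulation `T` of a convex heptagon and every polygon edge
`e`, there is a dominating set of at most two vertices containing an endpoint
of `e`. -/
theorem heptagon_dominating_with_edge (T : Finset (Finset (ZMod 7)))
    (hT : IsTriangulation 7 T) (e : Finset (ZMod 7)) (he : IsPolygonEdge 7 e) :
    ∃ S : Finset (ZMod 7), S.card ≤ 2 ∧ VertexDominates 7 T S ∧
      ∃ v ∈ e, v ∈ S := by
  obtain ⟨hc, hd, hx⟩ := hT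
  obtain ⟨v, rfl⟩ := he
  let I : Finset (Fin 14) := Finset.univ.filter fun i => hepD i ∈ T
  have hI : ∀ i, i ∈ I ↔ hepD i ∈ T := fun i => by simp [I]
  have himg : I.image hepD = T := by
    ext d
    rw [Finset.mem_image]
    constructor
    · rintro ⟨i, hi, rfl⟩
      exact (hI i).1 hi
    · intro h
      obtain ⟨i, rfl⟩ := hep_diag d (hd d h)
      exact ⟨i, (hI i).2 h, rfl⟩
  have hIc : I.card = 4 := by
    rw [← Finset.card_image_of_injective I hepD_inj, himg, hc]
  let f := I.orderEmbOfFin hIc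
  have hf : ∀ a, hepD (f a) ∈ T := fun a => (hI _).1 (Finset.orderEmbOfFin_mem I hIc a)
  have hncr : ∀ a b, a < b → hepCr (f a) (f b) = false := by
    intro a b hab
    by_contra h
    have hlt : f a < f b := f.lt_iff_lt.2 hab
    exact hx _ (hf a) _ (hf b) (fun h => hlt.ne (hepD_inj h))
      (hep_cross _ _ (by simpa using h))
  have hlt : ∀ a b, a < b → f a < f b := fun a b h => f.lt_iff_lt.2 h
  have hcov : ∀ d ∈ T, ∃ m ∈ [f 0, f 1, f 2, f 3], hepD m = d := by
    intro d h
    obtain ⟨i, rfl⟩ := hep_diag d (hd d h)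
    have hi : i ∈ Set.range f := by
      rw [Finset.range_orderEmbOfFin]
      exact (hI i).2 h
    obtain ⟨a, rfl⟩ := hi
    refine ⟨f a, ?_, rfl⟩
    fin_cases a <;> simp
  obtain ⟨w, h | h⟩ := hep_key (f 0) (f 1) (hlt _ _ (by decide)) (hncr _ _ (by decide))
    (f 2) (hlt _ _ (by decide)) (hncr _ _ (by decide)) (hncr _ _ (by decide))
    (f 3) (hlt _ _ (by decide)) (hncr _ _ (by decide)) (hncr _ _ (by decide))
    (hncr _ _ (by decide)) v
  · exact ⟨_, Finset.card_le_two, hep_sound T _ _ _ _ hcov _ w h, v,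
      Finset.mem_insert_self _ _, Finset.mem_insert_self _ _⟩
  · exact ⟨_, Finset.card_le_two, hep_sound T _ _ _ _ hcov _ w h, v + 1,
      Finset.mem_insert_of_mem (Finset.mem_singleton_self _), Finset.mem_insert_self _ _⟩
end

section
/- For every triangulation T of a convex octagon (n = 8), there exist a set S of at most 2 vertices that dominates T, a set H ⊆ T of at most 2 diagonals that dominates T, and an injective map f from H to S such that for every d ∈ H, f(d) is an endpoint of d. -/
namespace Oct

/-- Vertex with a given index. -/
def V (a : ℕ) : ZMod 8 := (a : ZMod 8)

/-- The unordered pair coded by a pair of indices. -/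
def dm (p : ℕ × ℕ) : Finset (ZMod 8) := {V p.1, V p.2}

def edgeB (a b : ℕ) : Bool := (a + 1) % 8 == b || (b + 1) % 8 == a

/-- All diagonals of the octagon. -/
def diags : List (ℕ × ℕ) :=
  (List.range 8).flatMap fun a => ((List.range 8).filter fun b =>
    Nat.blt a b && !edgeB a b).map fun b => (a, b)

def crossB (p q : ℕ × ℕ) : Bool := Nat.blt p.1 q.1 && Nat.blt q.1 p.2 && Nat.blt p.2 q.2

def eqB (p q : ℕ × ℕ) : Bool := Nat.beq p.1 q.1 && Nat.beq p.2 q.2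

def adj (acc : List (ℕ × ℕ)) (a b : ℕ) : Bool :=
  edgeB a b || acc.any fun d => eqB d (a, b) || eqB d (b, a)

def covers (v w a b c : ℕ) : Bool :=
  Nat.beq v a || Nat.beq v b || Nat.beq v c || Nat.beq w a || Nat.beq w b || Nat.beq w c

def dominates (acc : List (ℕ × ℕ)) (v w : ℕ) : Bool :=
  (List.range 8).all fun a => (List.range 8).all fun b =>
    !adj acc a b || (List.range 8).all fun c =>
      !(adj acc a c && adj acc b c) || covers v w a b c

def good (acc : List (ℕ × ℕ)) : Bool :=
  acc.any fun d => acc.any fun e => !eqB d e &&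
    [d.1, d.2].any fun v => [e.1, e.2].any fun w => !Nat.beq v w && dominates acc v w

/-- Enumerate the pairwise non-crossing subsets and test those with at least five elements. -/
def search : List (ℕ × ℕ) → List (ℕ × ℕ) → Bool
  | [], acc => !(Nat.ble 5 acc.length) || good acc
  | d :: ds, acc => search ds acc &&
      (!(acc.all fun e => !(crossB d e || crossB e d)) || search ds (d :: acc))

theorem search_diags : search diags [] = true := by decide +kernel

theorem search_sound (P : ℕ × ℕ → Prop) [DecidablePred P]
    (hP : ∀ d e, P d → P e → d ∈ diags → e ∈ diags → crossB d e = false)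
    (L acc : List (ℕ × ℕ)) (hL : ∀ d ∈ L, d ∈ diags) (hacc : ∀ d ∈ acc, P d ∧ d ∈ diags)
    (h : search L acc = true) :
    ∃ acc', (∀ d, d ∈ acc' ↔ d ∈ acc ∨ (d ∈ L ∧ P d)) ∧
      (5 ≤ acc'.length → good acc' = true) := by
  induction L generalizing acc with
  | nil =>
    refine ⟨acc, by simp, fun h5 => ?_⟩
    have h5' : Nat.ble 5 acc.length = true := Nat.ble_eq.mpr h5
    simpa [search, h5'] using h
  | cons d ds ih =>
    simp only [search, Bool.and_eq_true] at h
    obtain ⟨h1, h2⟩ := h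
    have hds : ∀ e ∈ ds, e ∈ diags := fun e he => hL e (List.mem_cons_of_mem _ he)
    have hd : d ∈ diags := hL d List.mem_cons_self
    by_cases hp : P d
    · have hall : (acc.all fun e => !(crossB d e || crossB e d)) = true := by
        rw [List.all_eq_true]
        intro e he
        rw [hP d e hp (hacc e he).1 hd (hacc e he).2, hP e d (hacc e he).1 hp (hacc e he).2 hd]
        rfl
      rw [hall] at h2
      obtain ⟨acc', ha, hg⟩ := ih (d :: acc) hds (by
        intro e he
        rcases List.mem_cons.mp he with rfl | he
        · exact ⟨hp, hd⟩
        · exact hacc e he) (by simpa using h2)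
      refine ⟨acc', fun e => ?_, hg⟩
      rw [ha, List.mem_cons, List.mem_cons]
      constructor
      · rintro ((rfl | h) | h)
        · exact Or.inr ⟨Or.inl rfl, hp⟩
        · exact Or.inl h
        · exact Or.inr ⟨Or.inr h.1, h.2⟩
      · rintro (h | ⟨rfl | h, h'⟩)
        · exact Or.inl (Or.inr h)
        · exact Or.inl (Or.inl rfl)
        · exact Or.inr ⟨h, h'⟩
    · obtain ⟨acc', ha, hg⟩ := ih acc hds hacc h1
      refine ⟨acc', fun e => ?_, hg⟩
      rw [ha, List.mem_cons]
      constructor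
      · rintro (h | h)
        · exact Or.inl h
        · exact Or.inr ⟨Or.inr h.1, h.2⟩
      · rintro (h | ⟨rfl | h, h'⟩)
        · exact Or.inl h
        · exact absurd h' hp
        · exact Or.inr ⟨h, h'⟩

theorem V_val (x : ZMod 8) : V x.val = x := ZMod.natCast_zmod_val x

theorem eqB_iff (p q : ℕ × ℕ) : eqB p q = true ↔ p = q := by
  simp [eqB, Prod.ext_iff]

theorem pair_mem : ∀ x y : ZMod 8, x ≠ y → x + 1 ≠ y → y + 1 ≠ x →
    (x.val, y.val) ∈ diags ∨ (y.val, x.val) ∈ diags := by decide +kernel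

theorem edge_edgeB : ∀ i : ZMod 8, edgeB i.val (i + 1).val = true ∧
    edgeB (i + 1).val i.val = true := by decide +kernel

theorem cross_arc : ∀ p ∈ diags, ∀ q ∈ diags, crossB p q = true →
    ((0 < (V q.1 - V p.1).val ∧ (V q.1 - V p.1).val < (V p.2 - V p.1).val) ∧
      (0 < (V q.2 - V p.2).val ∧ (V q.2 - V p.2).val < (V p.1 - V p.2).val)) ∧
    dm p ≠ dm q := by decide +kernel

theorem dm_inj : ∀ p ∈ diags, ∀ q ∈ diags, dm p = dm q → p = q := by decide +kernel

theorem V_inj : ∀ p ∈ diags, ∀ q ∈ diags, ∀ v ∈ [p.1, p.2], ∀ w ∈ [q.1, q.2],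
    V v = V w → v = w := by decide +kernel

theorem pair_edge (x y : ZMod 8) (h : x ≠ y) (he : IsPolygonEdge 8 {x, y}) :
    edgeB x.val y.val = true := by
  obtain ⟨i, hi⟩ := he
  have hx : x ∈ ({i, i + 1} : Finset (ZMod 8)) := hi ▸ by simp
  have hy : y ∈ ({i, i + 1} : Finset (ZMod 8)) := hi ▸ by simp
  simp only [Finset.mem_insert, Finset.mem_singleton] at hx hy
  rcases hx with rfl | rfl <;> rcases hy with rfl | rfl
  · exact absurd rfl h
  · exact (edge_edgeB _).1
  · exact (edge_edgeB _).2
  · exact absurd rfl h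

theorem diag_mem (x y : ZMod 8) (h : x ≠ y) (hd : IsDiagonal 8 {x, y}) :
    (x.val, y.val) ∈ diags ∨ (y.val, x.val) ∈ diags := by
  apply pair_mem x y h
  · rintro rfl
    exact hd.2 ⟨x, rfl⟩
  · rintro rfl
    exact hd.2 ⟨y, Finset.pair_comm _ _⟩

theorem main (T : Finset (Finset (ZMod 8))) (hT : IsTriangulation 8 T) :
    ∃ (S : Finset (ZMod 8)) (H : Finset (Finset (ZMod 8)))
      (f : Finset (ZMod 8) → ZMod 8),
      S.card ≤ 2 ∧ VertexDominates 8 T S ∧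
      H ⊆ T ∧ H.card ≤ 2 ∧ DiagDominates 8 T H ∧
      Set.InjOn f ↑H ∧ ∀ d ∈ H, f d ∈ d ∧ f d ∈ S := by
  obtain ⟨hcard, hdiag, hcr⟩ := hT
  obtain ⟨acc, hacc, hgood⟩ := search_sound (fun p => dm p ∈ T) (by
    intro d e hd he hd' he'
    by_contra hc
    rw [Bool.not_eq_false] at hc
    obtain ⟨⟨h1, h2⟩, h3⟩ := cross_arc d hd' e he' hc
    exact hcr _ hd _ he h3 ⟨V d.1, V d.2, V e.1, V e.2, rfl, rfl, h1, h2⟩)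
    diags [] (fun _ h => h) (by simp) search_diags
  have hacc' : ∀ d, d ∈ acc ↔ d ∈ diags ∧ dm d ∈ T := by
    intro d
    rw [hacc]
    simp
  have hpair : ∀ x y : ZMod 8, x ≠ y → {x, y} ∈ T →
      (x.val, y.val) ∈ acc ∨ (y.val, x.val) ∈ acc := by
    intro x y hxy hm
    rcases diag_mem x y hxy (hdiag _ hm) with h | h
    · left
      rw [hacc']
      refine ⟨h, ?_⟩
      simpa only [dm, V_val] using hm
    · right
      rw [hacc']
      refine ⟨h, ?_⟩
      rw [Finset.pair_comm] at hm
      simpa only [dm, V_val] using hm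
  have hsub : T ⊆ acc.toFinset.image dm := by
    intro d hd
    obtain ⟨x, y, hxy, rfl⟩ := Finset.card_eq_two.mp (hdiag d hd).1
    rw [Finset.mem_image]
    rcases hpair x y hxy hd with h | h
    · exact ⟨_, List.mem_toFinset.mpr h, by simp only [dm, V_val]⟩
    · exact ⟨_, List.mem_toFinset.mpr h, by simp only [dm, V_val]; exact Finset.pair_comm _ _⟩
  have hlen : 5 ≤ acc.length := by
    have h1 := Finset.card_le_card hsub
    have h2 : (acc.toFinset.image dm).card ≤ acc.toFinset.card := Finset.card_image_le
    have h3 := acc.toFinset_card_le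
    omega
  have hadj : ∀ x y : ZMod 8, x ≠ y → (IsPolygonEdge 8 {x, y} ∨ {x, y} ∈ T) →
      adj acc x.val y.val = true := by
    intro x y hxy h
    rw [adj, Bool.or_eq_true]
    rcases h with h | h
    · exact Or.inl (pair_edge x y hxy h)
    · right
      rw [List.any_eq_true]
      rcases hpair x y hxy h with h | h
      · exact ⟨_, h, by rw [Bool.or_eq_true, eqB_iff]; exact Or.inl rfl⟩
      · exact ⟨_, h, by rw [Bool.or_eq_true, eqB_iff, eqB_iff]; exact Or.inr rfl⟩
  have hg := hgood hlen
  simp only [good, List.any_eq_true, Bool.and_eq_true] at hg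
  obtain ⟨d, hd, e, he, hde, v, hv, w, hw, hvw, hdom⟩ := hg
  have hd' := (hacc' d).mp hd
  have he' := (hacc' e).mp he
  have hne : d ≠ e := by
    rintro rfl
    simp [(eqB_iff d d).mpr rfl] at hde
  have hvw' : V v ≠ V w := by
    intro h
    have := V_inj d hd'.1 e he'.1 v hv w hw h
    simp [this] at hvw
  have hdm : dm d ≠ dm e := fun h => hne (dm_inj d hd'.1 e he'.1 h)
  have hVd : V v ∈ dm d := by
    simp only [List.mem_cons, List.not_mem_nil, or_false] at hv
    rcases hv with rfl | rfl <;> simp [dm]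
  have hWe : V w ∈ dm e := by
    simp only [List.mem_cons, List.not_mem_nil, or_false] at hw
    rcases hw with rfl | rfl <;> simp [dm]
  have hdomT : ∀ t, IsTriangleOf 8 T t → V v ∈ t ∨ V w ∈ t := by
    rintro t ⟨htc, ht⟩
    obtain ⟨x, y, z, hxy, hxz, hyz, rfl⟩ := Finset.card_eq_three.mp htc
    have a1 := hadj x y hxy (ht x (by simp) y (by simp) hxy)
    have a2 := hadj x z hxz (ht x (by simp) z (by simp) hxz)
    have a3 := hadj y z hyz (ht y (by simp) z (by simp) hyz)
    simp only [dominates, List.all_eq_true] at hdom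
    have b1 := hdom x.val (List.mem_range.mpr (ZMod.val_lt x)) y.val
      (List.mem_range.mpr (ZMod.val_lt y))
    rw [a1, Bool.not_true, Bool.false_or, List.all_eq_true] at b1
    have b2 := b1 z.val (List.mem_range.mpr (ZMod.val_lt z))
    rw [a2, a3] at b2
    simp only [covers, Bool.and_self, Bool.not_true, Bool.false_or, Bool.or_eq_true,
      Nat.beq_eq] at b2
    rcases b2 with ((((h | h) | h) | h) | h) | h <;> rw [h, V_val] <;> simp
  refine ⟨{V v, V w}, {dm d, dm e}, fun s => if s = dm d then V v else V w,
    Finset.card_le_two, ?_, ?_, Finset.card_le_two, ?_, ?_, ?_⟩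
  · intro t ht
    rcases hdomT t ht with h | h
    · exact ⟨_, by simp, h⟩
    · exact ⟨_, by simp, h⟩
  · intro s hs
    simp only [Finset.mem_insert, Finset.mem_singleton] at hs
    rcases hs with rfl | rfl
    · exact hd'.2
    · exact he'.2
  · intro t ht
    rcases hdomT t ht with h | h
    · exact ⟨_, by simp, _, hVd, h⟩
    · exact ⟨dm e, by simp, _, hWe, h⟩
  · intro s hs s' hs' h
    simp only [Finset.coe_insert, Finset.coe_singleton, Set.mem_insert_iff,
      Set.mem_singleton_iff] at hs hs'
    rcases hs with rfl | rfl <;> rcases hs' with rfl | rfl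
    · rfl
    · simp only [if_true, if_neg hdm.symm] at h
      exact absurd h hvw'
    · simp only [if_true, if_neg hdm.symm] at h
      exact absurd h.symm hvw'
    · rfl
  · intro s hs
    simp only [Finset.mem_insert, Finset.mem_singleton] at hs
    rcases hs with rfl | rfl
    · simp only [if_true]
      exact ⟨hVd, by simp⟩
    · simp only [if_neg hdm.symm]
      exact ⟨hWe, by simp⟩

end Oct

/-- For every triangulation `T` of a convex octagon, there exist a dominating
set `S` of at most two vertices, a dominating set `H ⊆ T` of at most two
diagonals, and an injective map `f` on `H` assigning to each diagonal of `H`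
one of its endpoints, lying in `S`. -/
theorem octagon_candidate_vertices (T : Finset (Finset (ZMod 8)))
    (hT : IsTriangulation 8 T) :
    ∃ (S : Finset (ZMod 8)) (H : Finset (Finset (ZMod 8)))
      (f : Finset (ZMod 8) → ZMod 8),
      S.card ≤ 2 ∧ VertexDominates 8 T S ∧
      H ⊆ T ∧ H.card ≤ 2 ∧ DiagDominates 8 T H ∧
      Set.InjOn f ↑H ∧ ∀ d ∈ H, f d ∈ d ∧ f d ∈ S := by
  exact Oct.main T hT
end

section
/- For every triangulation T of a convex nonagon (n = 9), there exist a set S of at most 3 vertices that dominates T, a set H ⊆ T of at most 2 diagonals that dominates T, and an injective map f from H to S such that for every d ∈ H, f(d) is an endpoint of d. -/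
namespace Nonagon

/-- The side test for `a < b < 9`. -/
def pe (a b : ℕ) : Bool := Nat.beq b (a+1) || (Nat.beq a 0 && Nat.beq b 8)

/-- All pairs `a < b < 9`. -/
def pairs : List (ℕ × ℕ) :=
  (List.range 9).flatMap fun a => ((List.range 9).filter fun b => Nat.blt a b).map fun b => (a, b)

/-- The diagonals. -/
def diags : List (ℕ × ℕ) := pairs.filter fun x => !pe x.1 x.2

/-- All triples `a < b < c < 9`. -/
def triples : List (ℕ × ℕ × ℕ) :=
  (List.range 9).flatMap fun a => (pairs.filter fun p => Nat.blt a p.1).map fun p => (a, p)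

def peq (x y : ℕ × ℕ) : Bool := Nat.beq x.1 y.1 && Nat.beq x.2 y.2

/-- Two pairs do not cross. -/
def ncross (x y : ℕ × ℕ) : Bool :=
  !((Nat.blt x.1 y.1 && (Nat.blt y.1 x.2 && Nat.blt x.2 y.2)) ||
    (Nat.blt y.1 x.1 && (Nat.blt x.1 y.2 && Nat.blt y.2 x.2)))

def side (L : List (ℕ × ℕ)) (a b : ℕ) : Bool := pe a b || L.any (peq (a, b))

def isTri (L : List (ℕ × ℕ)) (t : ℕ × ℕ × ℕ) : Bool :=
  side L t.1 t.2.1 && (side L t.2.1 t.2.2 && side L t.1 t.2.2)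

def hit (v : ℕ) (t : ℕ × ℕ × ℕ) : Bool := Nat.beq v t.1 || (Nat.beq v t.2.1 || Nat.beq v t.2.2)

def good (ts : List (ℕ × ℕ × ℕ)) (d e : ℕ × ℕ) : Bool :=
  ts.all (fun t => (hit d.1 t || hit d.2 t) || (hit e.1 t || hit e.2 t)) &&
  [d.1, d.2].any fun u => [e.1, e.2].any fun v => !Nat.beq (u % 9) (v % 9) &&
    [d.1, d.2, e.1, e.2].any fun w => ts.all fun t => hit u t || (hit v t || hit w t)

def leafT (L : List (ℕ × ℕ)) (ts : List (ℕ × ℕ × ℕ)) : Bool :=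
  L.any fun d => L.any fun e => good ts d e

def leaf (L : List (ℕ × ℕ)) : Bool := leafT L (triples.filter (isTri L))

def search : ℕ → ℕ → List (ℕ × ℕ) → List (ℕ × ℕ) → Bool
  | 0, _, _, _ => false
  | _+1, 0, _, ch => leaf ch
  | _+1, _+1, [], _ => true
  | f+1, k+1, x :: xs, ch =>
    Nat.blt xs.length k ||
      (search f (k+1) xs ch && search f k (xs.filter (ncross x)) (x :: ch))

set_option maxRecDepth 100000 in
theorem search_true : search 28 6 diags [] = true := by decide +kernel

theorem search_spec (P : ℕ × ℕ → Bool)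
    (hP : ∀ x ∈ diags, ∀ y ∈ diags, P x = true → P y = true → ncross x y = true) :
    ∀ (f k : ℕ) (rem ch : List (ℕ × ℕ)), search f k rem ch = true →
      (∀ y ∈ rem, y ∈ diags) →
      (∀ y ∈ diags, P y = true → y ∈ ch ∨ y ∈ rem) → (∀ y ∈ ch, P y = true) →
      rem.countP P = k →
      ∃ L, leaf L = true ∧ (∀ y ∈ L, P y = true) ∧ ∀ y ∈ diags, P y = true → y ∈ L := by
  intro f
  induction f with
  | zero => intro k rem ch h; simp [search] at h
  | succ f ih =>
    intro k rem ch h hD hcov hch hk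
    cases k with
    | zero =>
      refine ⟨ch, by simpa [search] using h, hch, fun y hy hPy => ?_⟩
      rcases hcov y hy hPy with h1 | h1
      · exact h1
      · rw [List.countP_eq_zero] at hk
        exact absurd hPy (hk y h1)
    | succ k =>
      cases rem with
      | nil => simp at hk
      | cons x xs =>
        have hxD := hD x (by simp)
        have hxs : ∀ y ∈ xs, y ∈ diags := fun y hy => hD y (by simp [hy])
        simp only [search, Bool.or_eq_true, Bool.and_eq_true] at h
        rcases h with h | ⟨h1, h2⟩
        · have h3 : xs.length < k := by simpa using h
          have h4 := List.countP_le_length (p := P) (l := x :: xs)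
          simp at h4; omega
        · by_cases hx : P x = true
          · rw [List.countP_cons_of_pos hx] at hk
            refine ih k _ _ h2 ?_ ?_ ?_ ?_
            · intro y hy; exact hxs y (List.mem_filter.1 hy).1
            · intro y hy hPy
              rcases hcov y hy hPy with h5 | h5
              · left; simp [h5]
              · rcases List.mem_cons.1 h5 with h6 | h6
                · left; simp [h6]
                · right; exact List.mem_filter.2 ⟨h6, hP x hxD y hy hx hPy⟩
            · intro y hy
              rcases List.mem_cons.1 hy with h6 | h6
              · rw [h6]; exact hx
              · exact hch y h6
            · rw [List.countP_filter]
              have : xs.countP (fun a => P a && ncross x a) = xs.countP P := by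
                apply List.countP_congr
                intro y hy
                constructor
                · intro h7; simp at h7; exact h7.1
                · intro h7; simp [h7, hP x hxD y (hxs y hy) hx h7]
              rw [this]; omega
          · rw [List.countP_cons_of_neg hx] at hk
            refine ih (k+1) _ _ h1 hxs ?_ hch hk
            intro y hy hPy
            rcases hcov y hy hPy with h5 | h5
            · left; exact h5
            · rcases List.mem_cons.1 h5 with h6 | h6
              · subst h6; exact absurd hPy hx
              · right; exact h6

def toF (x : ℕ × ℕ) : Finset (ZMod 9) := {(x.1 : ZMod 9), (x.2 : ZMod 9)}

theorem pe_iff : ∀ b < 9, ∀ a < b, (pe a b = true ↔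
    ∃ i : ZMod 9, ({(a : ZMod 9), (b : ZMod 9)} : Finset (ZMod 9)) = {i, i + 1}) := by
  decide +kernel

theorem mem_diags : ∀ b < 9, ∀ a < b, pe a b = false → (a, b) ∈ diags := by
  intro b hb a hab h
  simp only [diags, pairs, List.mem_filter, List.mem_flatMap, List.mem_range, List.mem_map, h]
  exact ⟨⟨a, by omega, b, ⟨hb, by simpa using hab⟩, rfl⟩, rfl⟩

theorem diags_lt : ∀ x ∈ diags, x.1 < x.2 ∧ x.2 < 9 := by decide +kernel

theorem mem_triples : ∀ c < 9, ∀ b < c, ∀ a < b, (a, b, c) ∈ triples := by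
  intro c hc b hbc a hab
  simp only [triples, pairs, List.mem_filter, List.mem_flatMap, List.mem_range, List.mem_map]
  exact ⟨a, by omega, (b, c), ⟨⟨b, by omega, c, ⟨hc, by simpa using hbc⟩, rfl⟩,
    by simpa using hab⟩, rfl⟩

theorem nodup_diags : (diags.map toF).Nodup := by decide +kernel

theorem arc : ∀ a b c d : Fin 9, a < c → c < b → b < d →
    ((0 < (ZMod.val (n := 9) (c - a)) ∧ (ZMod.val (n := 9) (c - a)) < (ZMod.val (n := 9) (b - a))) ∧
     (0 < (ZMod.val (n := 9) (d - b)) ∧ (ZMod.val (n := 9) (d - b)) < (ZMod.val (n := 9) (a - b)))) ∧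
    ((0 < (ZMod.val (n := 9) (b - c)) ∧ (ZMod.val (n := 9) (b - c)) < (ZMod.val (n := 9) (d - c))) ∧
     (0 < (ZMod.val (n := 9) (a - d)) ∧ (ZMod.val (n := 9) (a - d)) < (ZMod.val (n := 9) (c - d)))) := by
  decide +kernel

theorem arcN (a b c d : ℕ) (h1 : a < c) (h2 : c < b) (h3 : b < d) (h4 : d < 9) :
    (InOpenArc 9 a b c ∧ InOpenArc 9 b a d) ∧ (InOpenArc 9 c d b ∧ InOpenArc 9 d c a) := by
  have e : ∀ m (h : m < 9), ((m : ℕ) : ZMod 9) = (⟨m, h⟩ : Fin 9) := by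
    intro m h
    interval_cases m <;> rfl
  rw [e a (by omega), e b (by omega), e c (by omega), e d (by omega)]
  exact arc ⟨a, by omega⟩ ⟨b, by omega⟩ ⟨c, by omega⟩ ⟨d, by omega⟩ h1 h2 h3

theorem cast_val (x : ZMod 9) : ((x.val : ℕ) : ZMod 9) = x := ZMod.natCast_zmod_val x

theorem cast_ne {a b : ℕ} (ha : a < 9) (hb : b < 9) (h : a ≠ b) : (a : ZMod 9) ≠ b := by
  intro h'
  rw [ZMod.natCast_eq_natCast_iff'] at h'
  omega

theorem ncross_of {T : Finset (Finset (ZMod 9))} (hT : IsTriangulation 9 T)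
    (x : ℕ × ℕ) (hx : x ∈ diags) (y : ℕ × ℕ) (hy : y ∈ diags)
    (hxT : toF x ∈ T) (hyT : toF y ∈ T) : ncross x y = true := by
  by_contra hc
  obtain ⟨a, b⟩ := x
  obtain ⟨c, d⟩ := y
  have hx' := diags_lt _ hx
  have hy' := diags_lt _ hy
  simp only at hx' hy'
  have hne : toF (a, b) ≠ toF (c, d) → False := by
    intro hne
    apply hT.2.2 _ hxT _ hyT hne
    simp only [ncross, Bool.not_eq_true', Bool.not_eq_false, Bool.or_eq_true, Bool.and_eq_true,
      Nat.blt_eq] at hc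
    rcases hc with ⟨h1, h2, h3⟩ | ⟨h1, h2, h3⟩
    · obtain ⟨h, -⟩ := arcN a b c d h1 h2 h3 hy'.2
      exact ⟨a, b, c, d, rfl, rfl, h⟩
    · obtain ⟨-, h⟩ := arcN c d a b h1 h2 h3 hx'.2
      exact ⟨a, b, d, c, rfl, Finset.pair_comm _ _, h⟩
  apply hne
  intro heq
  have hm : (a : ZMod 9) ∈ toF (c, d) := by rw [← heq]; simp [toF]
  have hm2 : (b : ZMod 9) ∈ toF (c, d) := by rw [← heq]; simp [toF]
  simp only [ncross, Bool.not_eq_true', Bool.not_eq_false, Bool.or_eq_true, Bool.and_eq_true,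
      Nat.blt_eq] at hc
  simp only [toF, Finset.mem_insert, Finset.mem_singleton] at hm hm2
  rcases hc with ⟨h1, h2, h3⟩ | ⟨h1, h2, h3⟩
  · rcases hm with h | h
    · exact cast_ne (by omega) (by omega) (by omega) h
    · exact cast_ne (by omega) (by omega) (by omega) h
  · rcases hm with h | h
    · exact cast_ne (by omega) (by omega) (by omega) h
    · exact cast_ne (by omega) (by omega) (by omega) h

theorem exists_diag {d : Finset (ZMod 9)} (hd : IsDiagonal 9 d) : ∃ x ∈ diags, toF x = d := by
  obtain ⟨hc, hp⟩ := hd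
  obtain ⟨x, y, hxy, rfl⟩ := Finset.card_eq_two.1 hc
  have key : ∀ x y : ZMod 9, x.val < y.val → ¬ IsPolygonEdge 9 {x, y} →
      ∃ z ∈ diags, toF z = {x, y} := by
    intro x y h hp
    refine ⟨(x.val, y.val), mem_diags _ (ZMod.val_lt y) _ h ?_, by simp [toF]⟩
    by_contra hpe
    have := (pe_iff _ (ZMod.val_lt y) _ h).1 (by simpa using hpe)
    rw [cast_val, cast_val] at this
    exact hp this
  rcases Nat.lt_trichotomy x.val y.val with h | h | h
  · exact key x y h hp
  · exact absurd (ZMod.val_injective 9 h) hxy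
  · rw [Finset.pair_comm] at hp ⊢
    exact key y x h hp

theorem count_six {T : Finset (Finset (ZMod 9))} (hT : IsTriangulation 9 T) :
    diags.countP (fun x => decide (toF x ∈ T)) = 6 := by
  have h : T = ((diags.filter fun x => decide (toF x ∈ T)).map toF).toFinset := by
    ext d
    simp only [List.mem_toFinset, List.mem_map, List.mem_filter, decide_eq_true_eq]
    constructor
    · intro hd
      obtain ⟨x, hx, rfl⟩ := exists_diag (hT.2.1 d hd)
      exact ⟨x, ⟨hx, hd⟩, rfl⟩
    · rintro ⟨x, ⟨-, h⟩, rfl⟩; exact h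
  have h2 := congrArg Finset.card h
  rw [List.toFinset_card_of_nodup, hT.1, List.length_map] at h2
  · rw [List.countP_eq_length_filter]; exact h2.symm
  · exact nodup_diags.sublist (List.filter_sublist.map toF)

theorem exists_triple {t : Finset (ZMod 9)} (ht : t.card = 3) :
    ∃ a b c : ℕ, a < b ∧ b < c ∧ c < 9 ∧ t = {(a : ZMod 9), (b : ZMod 9), (c : ZMod 9)} := by
  obtain ⟨x, y, z, hxy, hxz, hyz, rfl⟩ := Finset.card_eq_three.1 ht
  have h1 : x.val ≠ y.val := fun h => hxy (ZMod.val_injective 9 h)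
  have h2 : x.val ≠ z.val := fun h => hxz (ZMod.val_injective 9 h)
  have h3 : y.val ≠ z.val := fun h => hyz (ZMod.val_injective 9 h)
  have key : ∀ a b c : ZMod 9, a.val < b.val → b.val < c.val →
      ({x, y, z} : Finset (ZMod 9)) = {a, b, c} →
      ∃ a b c : ℕ, a < b ∧ b < c ∧ c < 9 ∧
        ({x, y, z} : Finset (ZMod 9)) = {(a : ZMod 9), (b : ZMod 9), (c : ZMod 9)} := by
    intro a b c h h' e
    refine ⟨a.val, b.val, c.val, h, h', ZMod.val_lt c, ?_⟩
    rw [cast_val, cast_val, cast_val, e]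
  rcases Nat.lt_or_gt_of_ne h1 with h1 | h1 <;> rcases Nat.lt_or_gt_of_ne h2 with h2 | h2 <;>
    rcases Nat.lt_or_gt_of_ne h3 with h3 | h3
  · exact key x y z h1 h3 rfl
  · exact key x z y h2 h3 (by ext; simp; tauto)
  · omega
  · exact key z x y h2 h1 (by ext; simp; tauto)
  · exact key y x z h1 h2 (by ext; simp; tauto)
  · omega
  · exact key y z x h3 h2 (by ext; simp; tauto)
  · exact key z y x h3 h1 (by ext; simp; tauto)

theorem exists_tri {T : Finset (Finset (ZMod 9))} {L : List (ℕ × ℕ)}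
    (hL : ∀ y ∈ diags, toF y ∈ T → y ∈ L) {t : Finset (ZMod 9)} (ht : IsTriangleOf 9 T t) :
    ∃ s ∈ triples.filter (isTri L), t = {(s.1 : ZMod 9), (s.2.1 : ZMod 9), (s.2.2 : ZMod 9)} := by
  obtain ⟨hc, hs⟩ := ht
  obtain ⟨a, b, c, hab, hbc, hc9, rfl⟩ := exists_triple hc
  refine ⟨(a, b, c), List.mem_filter.2 ⟨mem_triples c hc9 b hbc a hab, ?_⟩, rfl⟩
  have key : ∀ a b : ℕ, a < b → b < 9 →
      (IsPolygonEdge 9 {(a : ZMod 9), (b : ZMod 9)} ∨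
        ({(a : ZMod 9), (b : ZMod 9)} : Finset (ZMod 9)) ∈ T) →
      side L a b = true := by
    intro a b hab hb h
    by_cases hpe : pe a b = true
    · simp [side, hpe]
    · rcases h with h | h
      · exact absurd ((pe_iff b hb a hab).2 h) hpe
      · have := hL (a, b) (mem_diags b hb a hab (by simpa using hpe)) h
        simp only [side, Bool.or_eq_true, List.any_eq_true]
        exact Or.inr ⟨_, this, by simp [peq]⟩
  simp only [isTri, Bool.and_eq_true]
  refine ⟨key a b hab (by omega) ?_, key b c hbc hc9 ?_, key a c (by omega) hc9 ?_⟩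
  · exact hs _ (by simp) _ (by simp) (cast_ne (by omega) (by omega) (by omega))
  · exact hs _ (by simp) _ (by simp) (cast_ne (by omega) (by omega) (by omega))
  · exact hs _ (by simp) _ (by simp) (cast_ne (by omega) (by omega) (by omega))

theorem hit_mem {v : ℕ} {s : ℕ × ℕ × ℕ} (h : hit v s = true) :
    (v : ZMod 9) ∈ ({(s.1 : ZMod 9), (s.2.1 : ZMod 9), (s.2.2 : ZMod 9)} : Finset (ZMod 9)) := by
  simp only [hit, Bool.or_eq_true, Nat.beq_eq] at h
  rcases h with h | h | h <;> simp [h]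

end Nonagon

open Nonagon in
/-- For every triangulation `T` of a convex nonagon, there exist a dominating
set `S` of at most three vertices, a dominating set `H ⊆ T` of at most two
diagonals, and an injective map `f` on `H` assigning to each diagonal of `H`
one of its endpoints, lying in `S`. -/
theorem nonagon_candidate_vertices (T : Finset (Finset (ZMod 9)))
    (hT : IsTriangulation 9 T) :
    ∃ (S : Finset (ZMod 9)) (H : Finset (Finset (ZMod 9)))
      (f : Finset (ZMod 9) → ZMod 9),
      S.card ≤ 3 ∧ VertexDominates 9 T S ∧
      H ⊆ T ∧ H.card ≤ 2 ∧ DiagDominates 9 T H ∧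
      Set.InjOn f ↑H ∧ ∀ d ∈ H, f d ∈ d ∧ f d ∈ S := by
  obtain ⟨L, hleaf, hLT, hL⟩ := search_spec (fun x => decide (toF x ∈ T))
    (by
      intro x hx y hy h1 h2
      exact ncross_of hT x hx y hy (by simpa using h1) (by simpa using h2))
    28 6 diags [] search_true (fun _ h => h) (fun _ h _ => Or.inr h) (by simp) (count_six hT)
  simp only [decide_eq_true_eq] at hLT hL
  simp only [leaf, leafT, good, List.any_eq_true, Bool.and_eq_true, List.all_eq_true] at hleaf
  obtain ⟨d, hd, e, he, hdom, u, hu, v, hv, huv, w, -, hS⟩ := hleaf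
  have hud : (u : ZMod 9) ∈ toF d := by
    simp only [List.mem_cons, List.not_mem_nil, or_false] at hu
    rcases hu with h | h <;> simp [toF, h]
  have hve : (v : ZMod 9) ∈ toF e := by
    simp only [List.mem_cons, List.not_mem_nil, or_false] at hv
    rcases hv with h | h <;> simp [toF, h]
  have huv' : (u : ZMod 9) ≠ v := by
    intro h
    rw [ZMod.natCast_eq_natCast_iff'] at h
    simp [h] at huv
  refine ⟨{(u : ZMod 9), (v : ZMod 9), (w : ZMod 9)}, {toF d, toF e},
    fun x => if x = toF d then u else v, Finset.card_le_three, ?_, ?_, Finset.card_le_two,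
    ?_, ?_, ?_⟩
  · intro t ht
    obtain ⟨s, hs, rfl⟩ := exists_tri hL ht
    have := hS s hs
    simp only [Bool.or_eq_true] at this
    rcases this with h | h | h
    · exact ⟨_, by simp, hit_mem h⟩
    · exact ⟨_, by simp, hit_mem h⟩
    · exact ⟨_, by simp, hit_mem h⟩
  · intro x hx
    simp only [Finset.mem_insert, Finset.mem_singleton] at hx
    rcases hx with rfl | rfl
    · exact hLT _ hd
    · exact hLT _ he
  · intro t ht
    obtain ⟨s, hs, rfl⟩ := exists_tri hL ht
    have := hdom s hs
    simp only [Bool.or_eq_true] at this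
    rcases this with (h | h) | (h | h)
    · exact ⟨toF d, by simp, _, by simp [toF], hit_mem h⟩
    · exact ⟨toF d, by simp, _, by simp [toF], hit_mem h⟩
    · exact ⟨toF e, by simp, _, by simp [toF], hit_mem h⟩
    · exact ⟨toF e, by simp, _, by simp [toF], hit_mem h⟩
  · intro x hx y hy hxy
    simp only [Finset.coe_insert, Finset.coe_singleton, Set.mem_insert_iff,
      Set.mem_singleton_iff] at hx hy
    by_cases h1 : x = toF d <;> by_cases h2 : y = toF d
    · rw [h1, h2]
    · simp [h1, h2] at hxy; exact absurd hxy huv'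
    · simp [h1, h2] at hxy; exact absurd hxy.symm huv'
    · rw [hx.resolve_left h1, hy.resolve_left h2]
  · intro x hx
    simp only [Finset.mem_insert, Finset.mem_singleton] at hx
    by_cases h1 : x = toF d
    · simp only [h1, if_true]; exact ⟨hud, by simp⟩
    · have h2 := hx.resolve_left h1
      simp only [h1, if_false]
      exact ⟨h2 ▸ hve, by simp⟩
end

section
/- For every integer n ≥ 10 and every triangulation T of a convex n-gon, there exists a diagonal {i, j} ∈ T such that one of the two cyclic arcs of the polygon boundary between i and j contains exactly k polygon edges for some k with 4 ≤ k ≤ 8 (i.e., the diagonal cuts off a subpolygon with between 4 and 8 boundary edges of the original polygon). -/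
/-- A non-crossing family of intervals of length at least two inside `[0, m]` has at most
`m - 1` members: send each interval to the apex of its triangle. -/
theorem card_noncrossing_le (m : ℕ) (F : Finset (ℕ × ℕ))
    (h1 : ∀ p ∈ F, p.1 + 2 ≤ p.2 ∧ p.2 ≤ m)
    (h2 : ∀ p ∈ F, ∀ q ∈ F, ¬ (p.1 < q.1 ∧ q.1 < p.2 ∧ p.2 < q.2)) :
    F.card ≤ m - 1 := by
  classical
  have key : ∀ p ∈ F, ∃ c, p.1 < c ∧ c < p.2 ∧ (c = p.1 + 1 ∨ (p.1, c) ∈ F) ∧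
      ∀ b, b < p.2 → (p.1, b) ∈ F → b ≤ c := by
    intro p hp
    have hp1 := h1 p hp
    let S := (Finset.range p.2).filter (fun c => c = p.1 + 1 ∨ (p.1, c) ∈ F)
    have hS : S.Nonempty := ⟨p.1 + 1, by simp [S]; omega⟩
    have hm := Finset.max'_mem S hS
    have hle := Finset.le_max' S
    simp only [S, Finset.mem_filter, Finset.mem_range] at hm hle
    refine ⟨S.max' hS, ?_, hm.1, hm.2, fun b hb hbF => hle b ⟨hb, Or.inr hbF⟩⟩
    have : p.1 + 1 ≤ S.max' hS := hle (p.1 + 1) ⟨by omega, Or.inl rfl⟩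
    omega
  choose! f hf using key
  have aux : ∀ p ∈ F, ∀ q ∈ F, f p = f q → q.1 ≤ p.1 → p.2 ≤ q.2 → p = q := by
    intro p hp q hq hpq ha hb
    obtain ⟨p1, p2, p3, p4⟩ := hf p hp
    obtain ⟨q1, q2, q3, q4⟩ := hf q hq
    rcases Nat.eq_or_lt_of_le ha with ha | ha
    · rcases Nat.eq_or_lt_of_le hb with hb | hb
      · exact Prod.ext ha.symm hb
      · have := q4 p.2 hb (by rw [ha]; exact hp)
        omega
    · rcases q3 with q3 | q3
      · omega
      · exact absurd ⟨by simpa using ha, by simp; omega, by simp; omega⟩ (h2 _ q3 p hp)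
  have hc : F.card ≤ (Finset.Ioo 0 m).card := by
    apply Finset.card_le_card_of_injOn f
    · intro p hp
      have := hf p hp
      have := h1 p hp
      simp only [Finset.coe_Ioo, Set.mem_Ioo]
      omega
    · intro p hp q hq hpq
      have hp : p ∈ F := hp
      have hq : q ∈ F := hq
      have a1 := hf p hp
      have a2 := hf q hq
      have a3 := h2 p hp q hq
      have a4 := h2 q hq p hp
      by_cases h : q.1 ≤ p.1 ∧ p.2 ≤ q.2
      · exact aux p hp q hq hpq h.1 h.2
      · exact (aux q hq p hp hpq.symm (by omega) (by omega)).symm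
  simpa using hc

theorem cast_sub_val (n : ℕ) (a b : ℕ) (hab : a ≤ b) (hb : b < n) (i : ZMod n) :
    ((i + (b : ZMod n)) - (i + (a : ZMod n))).val = b - a := by
  have : (i + (b : ZMod n)) - (i + (a : ZMod n)) = ((b - a : ℕ) : ZMod n) := by
    rw [Nat.cast_sub hab]; ring
  rw [this, ZMod.val_natCast_of_lt (by omega)]

theorem cast_sub_val' (n : ℕ) (a b : ℕ) (hab : a < b) (hb : b < n) (i : ZMod n) :
    ((i + (a : ZMod n)) - (i + (b : ZMod n))).val = n - (b - a) := by
  have : (i + (a : ZMod n)) - (i + (b : ZMod n)) = ((n - (b - a) : ℕ) : ZMod n) := by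
    rw [Nat.cast_sub (by omega), Nat.cast_sub hab.le, ZMod.natCast_self]; ring
  rw [this, ZMod.val_natCast_of_lt (by omega)]

theorem cast_inj_aux (n : ℕ) (a b : ℕ) (ha : a < n) (hb : b < n) (i : ZMod n)
    (h : i + (a : ZMod n) = i + (b : ZMod n)) : a = b := by
  have := congrArg ZMod.val (add_left_cancel h)
  rwa [ZMod.val_natCast_of_lt ha, ZMod.val_natCast_of_lt hb] at this

theorem exists_apex (n : ℕ) (hn : 10 ≤ n)
    (T : Finset (Finset (ZMod n))) (hT : IsTriangulation n T) (i : ZMod n) (k : ℕ)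
    (hk : k < n) (hk2 : 2 ≤ k) (hkT : ({i + (0 : ℕ), i + (k : ZMod n)} : Finset (ZMod n)) ∈ T) :
    ∃ c, 0 < c ∧ c < k ∧ (c = 1 ∨ ({i + (0 : ℕ), i + (c : ZMod n)} : Finset (ZMod n)) ∈ T) ∧
      (c + 1 = k ∨ ({i + (c : ZMod n), i + (k : ZMod n)} : Finset (ZMod n)) ∈ T) := by
  classical
  have : NeZero n := ⟨by omega⟩
  obtain ⟨hcard, hdiag, hnc⟩ := hT
  let F : Finset (ℕ × ℕ) := (Finset.range n ×ˢ Finset.range n).filter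
    (fun p => p.1 + 2 ≤ p.2 ∧ ({i + (p.1 : ZMod n), i + (p.2 : ZMod n)} : Finset (ZMod n)) ∈ T)
  have memF : ∀ a b, (a, b) ∈ F ↔ (a + 2 ≤ b ∧ b < n ∧
      ({i + (a : ZMod n), i + (b : ZMod n)} : Finset (ZMod n)) ∈ T) := by
    intro a b
    simp only [F, Finset.mem_filter, Finset.mem_product, Finset.mem_range]
    constructor
    · rintro ⟨h1, h2, h3⟩; exact ⟨h2, h1.2, h3⟩
    · rintro ⟨h1, h2, h3⟩; exact ⟨⟨by omega, h2⟩, h1, h3⟩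
  have hFnc : ∀ a b c d, (a, b) ∈ F → (c, d) ∈ F → ¬ (a < c ∧ c < b ∧ b < d) := by
    rintro a b c d h1 h2 ⟨h3, h4, h5⟩
    rw [memF] at h1 h2
    refine hnc _ h1.2.2 _ h2.2.2 ?_ ⟨_, _, _, _, rfl, rfl, ?_, ?_⟩
    · intro he
      have : i + (c : ZMod n) ∈ ({i + (a : ZMod n), i + (b : ZMod n)} : Finset (ZMod n)) := by
        rw [he]; simp
      rw [Finset.mem_insert, Finset.mem_singleton] at this
      rcases this with h | h
      · have := cast_inj_aux n c a (by omega) (by omega) i h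
        omega
      · have := cast_inj_aux n c b (by omega) (by omega) i h
        omega
    · unfold InOpenArc
      rw [cast_sub_val n a c (by omega) (by omega), cast_sub_val n a b (by omega) (by omega)]
      omega
    · unfold InOpenArc
      rw [cast_sub_val n b d (by omega) (by omega), cast_sub_val' n a b (by omega) (by omega)]
      omega
  have hTF : T ⊆ F.image (fun p => ({i + (p.1 : ZMod n), i + (p.2 : ZMod n)} : Finset (ZMod n))) := by
    have aux : ∀ x y : ZMod n, ({x, y} : Finset (ZMod n)) ∈ T → (x - i).val < (y - i).val →
        ({x, y} : Finset (ZMod n)) ∈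
          F.image (fun p => ({i + (p.1 : ZMod n), i + (p.2 : ZMod n)} : Finset (ZMod n))) := by
      intro x y hd hlt
      have hx : i + (((x - i).val : ℕ) : ZMod n) = x := by
        rw [ZMod.natCast_zmod_val]; ring
      have hy : i + (((y - i).val : ℕ) : ZMod n) = y := by
        rw [ZMod.natCast_zmod_val]; ring
      refine Finset.mem_image.2 ⟨((x - i).val, (y - i).val), (memF _ _).2 ⟨?_, ZMod.val_lt _, ?_⟩, ?_⟩
      · by_contra hcon
        have he : (y - i).val = (x - i).val + 1 := by omega
        refine (hdiag _ hd).2 ⟨x, ?_⟩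
        rw [he] at hy
        push_cast at hy
        rw [← add_assoc] at hy
        have hx' : i + (x - i) = x := by ring
        rw [ZMod.natCast_zmod_val, hx'] at hy
        rw [hy]
      · rw [hx, hy]; exact hd
      · simp only [hx, hy]
    intro d hd
    obtain ⟨x, y, hxy, rfl⟩ := Finset.card_eq_two.1 (hdiag d hd).1
    rcases lt_trichotomy (x - i).val (y - i).val with h | h | h
    · exact aux x y hd h
    · exact absurd (sub_left_injective (ZMod.val_injective n h)) hxy
    · rw [Finset.pair_comm] at hd ⊢
      exact aux y x hd h
  have hFcard : n - 3 ≤ F.card := by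
    rw [← hcard]
    exact (Finset.card_le_card hTF).trans Finset.card_image_le
  have h0 : (0, n - 1) ∉ F := by
    rw [memF]
    rintro ⟨_, _, h⟩
    refine (hdiag _ h).2 ⟨i + ((n - 1 : ℕ) : ZMod n), ?_⟩
    rw [Nat.cast_sub (by omega), Finset.pair_comm]
    simp
  have hkF : (0, k) ∈ F := (memF _ _).2 ⟨by omega, hk, hkT⟩
  have hkn : k < n - 1 := by
    rcases Nat.lt_or_ge k (n - 1) with h | h
    · exact h
    · have : k = n - 1 := by omega
      exact absurd (this ▸ hkF) h0
  let S := (Finset.range k).filter (fun c => c = 1 ∨ (0, c) ∈ F)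
  have hS : S.Nonempty := ⟨1, by simp [S]; omega⟩
  have hm := Finset.max'_mem S hS
  have hle := Finset.le_max' S
  simp only [S, Finset.mem_filter, Finset.mem_range] at hm hle
  have hc1 := hle 1 ⟨by omega, Or.inl rfl⟩
  change _ ≤ S.max' hS at hc1
  change S.max' hS < k ∧ (S.max' hS = 1 ∨ (0, S.max' hS) ∈ F) at hm
  have hle' : ∀ b, b < k → (0, b) ∈ F → b ≤ S.max' hS := fun b h1 h2 => hle b ⟨h1, Or.inr h2⟩
  generalize S.max' hS = c at hm hc1 hle'
  refine ⟨c, by omega, hm.1, hm.2.imp id (fun h => ((memF _ _).1 h).2.2), ?_⟩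
  by_contra hcon
  push Not at hcon
  have hck : (c, k) ∉ F := fun h => hcon.2 ((memF _ _).1 h).2.2
  have hb : (insert (c, k) (insert (0, n - 1) F)).card ≤ (n - 1) - 1 := by
    apply card_noncrossing_le
    · rintro ⟨a, b⟩ h
      simp only [Finset.mem_insert, Prod.mk.injEq] at h
      rcases h with h | h | h
      · simp only; omega
      · simp only; omega
      · have := (memF _ _).1 h
        simp only; omega
    · rintro ⟨a, b⟩ h ⟨a', b'⟩ h'
      have bd : ∀ x y, (x, y) ∈ F → x + 2 ≤ y ∧ y < n := fun x y h =>
        ⟨((memF _ _).1 h).1, ((memF _ _).1 h).2.1⟩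
      simp only [Finset.mem_insert, Prod.mk.injEq] at h h'
      simp only
      rcases h with h | h | h <;> rcases h' with h' | h' | h'
      · omega
      · omega
      · have := bd _ _ h'
        have := hFnc _ _ _ _ hkF h'
        omega
      · omega
      · omega
      · have := bd _ _ h'
        omega
      · -- a < c < b < k
        rintro ⟨h3, h4, h5⟩
        obtain ⟨rfl, rfl⟩ := h'
        rcases Nat.eq_zero_or_pos a with rfl | ha
        · have := hle' b h5 h
          omega
        · rcases hm.2 with h6 | h6
          · omega
          · exact hFnc _ _ _ _ h6 h ⟨ha, h3, h4⟩
      · omega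
      · exact hFnc _ _ _ _ h h'
  rw [Finset.card_insert_of_notMem, Finset.card_insert_of_notMem h0] at hb
  · omega
  · simp only [Finset.mem_insert, Prod.mk.injEq, not_or]
    exact ⟨by omega, hck⟩

theorem exists_separating_diagonal (n : ℕ) (hn : 10 ≤ n)
    (T : Finset (Finset (ZMod n))) (hT : IsTriangulation n T) :
    ∃ i j : ZMod n, ({i, j} : Finset (ZMod n)) ∈ T ∧
      ∃ k : ℕ, 4 ≤ k ∧ k ≤ 8 ∧ (j - i).val = k := by
  classical
  have : NeZero n := ⟨by omega⟩
  let P : ℕ → Prop := fun k => 4 ≤ k ∧ k < n ∧ ∃ i : ZMod n,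
    ({i, i + (k : ZMod n)} : Finset (ZMod n)) ∈ T
  have hP : ∃ k, P k := by
    have hne : T.Nonempty := by
      rw [← Finset.card_pos, hT.1]; omega
    obtain ⟨d, hd⟩ := hne
    obtain ⟨x, y, hxy, rfl⟩ := Finset.card_eq_two.1 (hT.2.1 d hd).1
    by_cases h : 4 ≤ (y - x).val
    · refine ⟨(y - x).val, h, ZMod.val_lt _, x, ?_⟩
      rw [ZMod.natCast_zmod_val, add_sub_cancel]
      exact hd
    · refine ⟨(x - y).val, ?_, ZMod.val_lt _, y, ?_⟩
      · have h1 : x - y = -(y - x) := by ring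
        have h2 : y - x ≠ 0 := sub_ne_zero.2 (Ne.symm hxy)
        have : NeZero (y - x) := ⟨h2⟩
        rw [h1, ZMod.val_neg_of_ne_zero]
        omega
      · rw [ZMod.natCast_zmod_val, add_sub_cancel, Finset.pair_comm]
        exact hd
  obtain ⟨h4, hkn, i, hi⟩ := Nat.find_spec hP
  have hmin : ∀ m, m < Nat.find hP → ¬ P m := fun m => Nat.find_min hP
  generalize Nat.find hP = k at h4 hkn hi hmin
  obtain ⟨c, c0, ck, hc1, hc2⟩ := exists_apex n hn T hT i k hkn (by omega) (by simpa using hi)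
  have hc3 : c ≤ 3 := by
    rcases hc1 with h | h
    · omega
    · by_contra hcon
      exact hmin c ck ⟨by omega, by omega, i, by simpa using h⟩
  have hc4 : k - c ≤ 3 := by
    rcases hc2 with h | h
    · omega
    · by_contra hcon
      refine hmin (k - c) (by omega) ⟨by omega, by omega, i + (c : ZMod n), ?_⟩
      rw [Nat.cast_sub ck.le, add_assoc, add_sub_cancel]
      exact h
  refine ⟨i, i + (k : ZMod n), hi, k, h4, by omega, ?_⟩
  rw [add_sub_cancel_left, ZMod.val_natCast_of_lt hkn]
end
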